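/- Let c₁ ≤ c₂ < a^K. Then Φ_s(c₁)·Φ_t(c₂) ≥ Φ_s(c₂)·Φ_t(c₁); equivalently, the ratio Φ_s(c)/Φ_t(c) is nonincreasing in c on (−∞, a^K). -/

import Mathlib

/-- A maximum of `(a k - c) * G k` over `1 ≤ k ≤ K` with `c < a K` is attained at an index
with `c < a k`. -/
theorem exists_sup'_eq_of_lt {K : ℕ} (hK : 1 ≤ K) {a G : ℕ → ℝ}
    (hG : ∀ k, 1 ≤ k → k ≤ K → 0 < G k) {c : ℝ} (hc : c < a K) :
    ∃ i, 1 ≤ i ∧ i ≤ K ∧ c < a i ∧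
      (Finset.Icc 1 K).sup' (Finset.nonempty_Icc.mpr hK) (fun k => (a k - c) * G k) =
        (a i - c) * G i := by
  obtain ⟨i, hi, h⟩ := Finset.exists_mem_eq_sup' (Finset.nonempty_Icc.mpr hK)
    (fun k => (a k - c) * G k)
  have hle := Finset.le_sup' (fun k => (a k - c) * G k) (Finset.mem_Icc.mpr ⟨hK, le_refl K⟩)
  obtain ⟨hi1, hiK⟩ := Finset.mem_Icc.mp hi
  refine ⟨i, hi1, hiK, ?_, h⟩
  have hpos : 0 < (a i - c) * G i := by
    rw [h] at hle
    exact (mul_pos (sub_pos.mpr hc) (hG K hK le_rfl)).trans_le hle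
  exact sub_pos.mp (pos_of_mul_pos_left hpos (hG i hi1 hiK).le)

/-- If the ratio G_s/G_t is nonincreasing in k, then for
c₁ ≤ c₂ < a^K, Φ_s(c₁)·Φ_t(c₂) ≥ Φ_s(c₂)·Φ_t(c₁); i.e. Φ_s(c)/Φ_t(c) is
nonincreasing on (−∞, a^K). -/
theorem stmt_13 (K : ℕ) (hK : 1 ≤ K) (a Gs Gt : ℕ → ℝ)
    (ha : ∀ k, 1 ≤ k → k < K → a k < a (k + 1))
    (hGs : ∀ k, 1 ≤ k → k ≤ K → 0 < Gs k)
    (hGt : ∀ k, 1 ≤ k → k ≤ K → 0 < Gt k)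
    (hratio : ∀ j k, 1 ≤ j → j ≤ k → k ≤ K → Gs k / Gt k ≤ Gs j / Gt j)
    (Φs Φt : ℝ → ℝ)
    (hΦs : ∀ c, Φs c = (Finset.Icc 1 K).sup' (Finset.nonempty_Icc.mpr hK)
      (fun k => (a k - c) * Gs k))
    (hΦt : ∀ c, Φt c = (Finset.Icc 1 K).sup' (Finset.nonempty_Icc.mpr hK)
      (fun k => (a k - c) * Gt k)) :
    ∀ c₁ c₂ : ℝ, c₁ ≤ c₂ → c₂ < a K → Φs c₁ * Φt c₂ ≥ Φs c₂ * Φt c₁ := by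
  intro c₁ c₂ hc hcK
  have hmono : ∀ i j, 1 ≤ i → i ≤ j → j ≤ K → a i ≤ a j := by
    intro i j hi hij
    induction j, hij using Nat.le_induction with
    | base => exact fun _ => le_rfl
    | succ n hn ih => exact fun h => (ih (by omega)).trans (ha n (by omega) (by omega)).le
  have hle_s : ∀ c k, 1 ≤ k → k ≤ K → (a k - c) * Gs k ≤ Φs c := fun c k h1 h2 => by
    rw [hΦs]
    exact Finset.le_sup' (fun k => (a k - c) * Gs k) (Finset.mem_Icc.mpr ⟨h1, h2⟩)
  have hle_t : ∀ c k, 1 ≤ k → k ≤ K → (a k - c) * Gt k ≤ Φt c := fun c k h1 h2 => by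
    rw [hΦt]
    exact Finset.le_sup' (fun k => (a k - c) * Gt k) (Finset.mem_Icc.mpr ⟨h1, h2⟩)
  obtain ⟨i, hi1, hiK, hci, hi⟩ := exists_sup'_eq_of_lt hK hGs hcK
  obtain ⟨j, hj1, hjK, hcj, hj⟩ := exists_sup'_eq_of_lt hK hGt (hc.trans_lt hcK)
  rw [ge_iff_le, hΦs c₂, hi, hΦt c₁, hj]
  have hsi := hGs i hi1 hiK
  have htj := hGt j hj1 hjK
  have hti := hGt i hi1 hiK
  have hsj := hGs j hj1 hjK
  have hi2 := sub_pos.mpr hci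
  have hj₁ := sub_pos.mpr hcj
  rcases le_or_gt j i with hji | hij
  · have hr : Gs i * Gt j ≤ Gs j * Gt i := (div_le_div_iff₀ hti htj).mp (hratio j i hj1 hji hiK)
    calc (a i - c₂) * Gs i * ((a j - c₁) * Gt j)
        = (a i - c₂) * (a j - c₁) * (Gs i * Gt j) := by ring
      _ ≤ (a i - c₂) * (a j - c₁) * (Gs j * Gt i) := by gcongr
      _ = (a j - c₁) * Gs j * ((a i - c₂) * Gt i) := by ring
      _ ≤ Φs c₁ * Φt c₂ :=
        mul_le_mul (hle_s c₁ j hj1 hjK) (hle_t c₂ i hi1 hiK) (by positivity)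
          ((mul_pos hj₁ hsj).le.trans (hle_s c₁ j hj1 hjK))
  · have haij := hmono i j hi1 hij.le hjK
    have hi₁ : 0 < a i - c₁ := by linarith
    have hj2 : 0 < a j - c₂ := by linarith
    have hcross : (a i - c₂) * (a j - c₁) ≤ (a i - c₁) * (a j - c₂) := by
      nlinarith [mul_nonneg (sub_nonneg.mpr haij) (sub_nonneg.mpr hc)]
    calc (a i - c₂) * Gs i * ((a j - c₁) * Gt j)
        = (a i - c₂) * (a j - c₁) * (Gs i * Gt j) := by ring
      _ ≤ (a i - c₁) * (a j - c₂) * (Gs i * Gt j) := by gcongr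
      _ = (a i - c₁) * Gs i * ((a j - c₂) * Gt j) := by ring
      _ ≤ Φs c₁ * Φt c₂ :=
        mul_le_mul (hle_s c₁ i hi1 hiK) (hle_t c₂ j hj1 hjK) (by positivity)
          ((mul_pos hi₁ hsi).le.trans (hle_s c₁ i hi1 hiK))
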